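/- Let p be a depth-zero, bifix-free pattern of dimensions a×c. Then for all integers n ≥ 1 and m ≥ n: s_p(n, m) + s_p(n−a, m−c) = s_p(n−1, m) + s_p(n, m−1). -/

import Mathlib

/-- A step of a lattice path: `u` (up) or `r` (right). -/
inductive Step : Type
  | u : Step
  | r : Step
deriving DecidableEq

/-- A word over the alphabet `{u, r}`. -/
abbrev Word := List Step

/-- The number of letters `r` in a word. -/
def countR (w : Word) : ℕ := w.count Step.r

/-- The number of letters `u` in a word. -/
def countU (w : Word) : ℕ := w.count Step.u

/-- `dval q` = (number of `r`'s in `q`) - (number of `u`'s in `q`). -/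
def dval (w : Word) : ℤ := (countR w : ℤ) - (countU w : ℤ)

/-- A pattern is depth-zero if every suffix `q` of it satisfies `dval q ≥ 0`. -/
def DepthZero (p : Word) : Prop := ∀ q : Word, q <:+ p → 0 ≤ dval q

/-- `o` is a bifix of `p`: a nonempty proper prefix of `p` that is also a (proper) suffix. -/
def IsBifix (o p : Word) : Prop := o ≠ [] ∧ o ≠ p ∧ o <+: p ∧ o <:+ p

/-- A pattern is bifix-free if it has no bifix. -/
def BifixFree (p : Word) : Prop := ∀ o : Word, ¬ IsBifix o p

/-- `w` is a ballot path to the lattice point `(n, m)`: it has exactly `n` letters `r`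
and `m` letters `u`, and every prefix has at least as many `u`'s as `r`'s. -/
def IsBallot (w : Word) (n m : ℤ) : Prop :=
  (countR w : ℤ) = n ∧ (countU w : ℤ) = m ∧
    ∀ t : Word, t <+: w → countR t ≤ countU t

/-- `w` avoids the pattern `p`: `p` does not occur in `w` as a contiguous substring. -/
def Avoids (p w : Word) : Prop := ¬ p <:+: w

/-- `s p n m` is the number of ballot paths to `(n, m)` avoiding `p`
(`0` if `n < 0`, `m < 0`, or `m < n`, since then no such path exists). -/
noncomputable def s (p : Word) (n m : ℤ) : ℕ :=
  Set.ncard {w : Word | IsBallot w n m ∧ Avoids p w}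

instance : Finite Step :=
  Finite.of_injective (fun x : Step => decide (x = Step.u)) (by
    intro x y h
    cases x <;> cases y <;> simp_all)

theorem length_eq_countR_add_countU (w : Word) : w.length = countR w + countU w := by
  induction w with
  | nil => rfl
  | cons x w ih => cases x <;> simp [countR, countU] at * <;> omega

theorem countR_append (v w : Word) : countR (v ++ w) = countR v + countR w :=
  List.count_append

theorem countU_append (v w : Word) : countU (v ++ w) = countU v + countU w :=
  List.count_append

/-- Ballot paths to `(n, m)` that avoid `p`. -/
def avoidingBallots (p : Word) (n m : ℤ) : Set Word := {w | IsBallot w n m ∧ Avoids p w}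

theorem finite_avoidingBallots (p : Word) (n m : ℤ) : (avoidingBallots p n m).Finite := by
  refine (List.finite_length_eq Step (n + m).toNat).subset ?_
  rintro w ⟨⟨hR, hU, -⟩, -⟩
  have := length_eq_countR_add_countU w
  simp only [Set.mem_ofPred_eq]
  omega

theorem isBallot_concat_r {v : Word} {n m : ℤ} (hm : n ≤ m) :
    IsBallot (v ++ [Step.r]) n m ↔ IsBallot v (n - 1) m := by
  have hR : countR (v ++ [Step.r]) = countR v + 1 := countR_append _ _
  have hU : countU (v ++ [Step.r]) = countU v := countU_append _ _
  constructor
  · rintro ⟨h1, h2, h3⟩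
    exact ⟨by omega, by omega, fun t ht => h3 t (ht.trans (List.prefix_append _ _))⟩
  · rintro ⟨h1, h2, h3⟩
    refine ⟨by omega, by omega, fun t ht => ?_⟩
    rcases List.prefix_concat_iff.1 ht with rfl | ht
    · omega
    · exact h3 t ht

theorem isBallot_concat_u {v : Word} {n m : ℤ} :
    IsBallot (v ++ [Step.u]) n m ↔ IsBallot v n (m - 1) := by
  have hR : countR (v ++ [Step.u]) = countR v := countR_append _ _
  have hU : countU (v ++ [Step.u]) = countU v + 1 := countU_append _ _
  constructor
  · rintro ⟨h1, h2, h3⟩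
    exact ⟨by omega, by omega, fun t ht => h3 t (ht.trans (List.prefix_append _ _))⟩
  · rintro ⟨h1, h2, h3⟩
    refine ⟨by omega, by omega, fun t ht => ?_⟩
    rcases List.prefix_concat_iff.1 ht with rfl | ht
    · have := h3 v List.prefix_rfl
      omega
    · exact h3 t ht

/-- Appending a depth-zero pattern to a ballot path keeps it ballot as long as the endpoint is
weakly above the diagonal. -/
theorem DepthZero.isBallot_append_iff {p t : Word} (hp : DepthZero p) {n m : ℤ} (hm : n ≤ m) :
    IsBallot (t ++ p) n m ↔ IsBallot t (n - countR p) (m - countU p) := by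
  have hR := countR_append t p
  have hU := countU_append t p
  constructor
  · rintro ⟨h1, h2, h3⟩
    exact ⟨by omega, by omega, fun q hq => h3 q (hq.trans (List.prefix_append _ _))⟩
  · rintro ⟨h1, h2, h3⟩
    refine ⟨by omega, by omega, fun q hq => ?_⟩
    rcases List.prefix_or_prefix_of_prefix hq (List.prefix_append t p) with h | ⟨o, rfl⟩
    · exact h3 q h
    · obtain ⟨y, rfl⟩ := (List.prefix_append_right_inj t).1 hq
      have hy := hp y (List.suffix_append _ _)
      have := countR_append t o
      have := countU_append t o
      have := countR_append o y
      have := countU_append o y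
      unfold dval at hy
      omega

/-- Appending a proper prefix of a bifix-free pattern to a word avoiding the pattern
creates no occurrence of it. -/
theorem BifixFree.avoids_append_of_prefix {p t o : Word} (hp : BifixFree p) (ht : Avoids p t)
    (ho : o <+: p) (hne : o ≠ p) : Avoids p (t ++ o) := by
  rintro ⟨x, y, hxy⟩
  have hlen : o.length < p.length :=
    lt_of_le_of_ne ho.length_le fun h => hne (ho.eq_of_length h)
  rcases List.prefix_or_prefix_of_prefix (List.prefix_append (x ++ p) y)
    (hxy ▸ List.prefix_append t o) with h | ⟨q, hq⟩
  · exact ht ((List.suffix_append x p).isInfix.trans h.isInfix)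
  · have hqo : q <+: o := by
      rw [← List.prefix_append_right_inj t, hq, ← hxy]
      exact List.prefix_append _ _
    have hql := hqo.length_le
    refine hp q ⟨?_, ?_, hqo.trans ho, ?_⟩
    · rintro rfl
      rw [List.append_nil] at hq
      exact ht (hq ▸ (List.suffix_append x p).isInfix)
    · rintro rfl
      omega
    · exact List.suffix_of_suffix_length_le (hq ▸ List.suffix_append t q)
        (List.suffix_append x p) (by omega)

theorem BifixFree.avoids_concat_or_iff {p v : Word} {x : Step} (hp : BifixFree p) (hne : p ≠ []) :
    (Avoids p (v ++ [x]) ∨ ∃ t, Avoids p t ∧ t ++ p = v ++ [x]) ↔ Avoids p v := by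
  constructor
  · rintro (h | ⟨t, ht, h⟩)
    · exact fun hv => h (hv.trans (List.prefix_append _ _).isInfix)
    · obtain ⟨q, z, rfl⟩ := List.eq_nil_or_concat p |>.resolve_left hne
      rw [List.concat_eq_append, ← List.append_assoc] at h
      rw [← (List.append_inj' h rfl).1]
      exact hp.avoids_append_of_prefix ht (by simp) (by simp)
  · intro hv
    by_cases h : Avoids p (v ++ [x])
    · exact Or.inl h
    · obtain h | h := List.infix_concat_iff.1 (not_not.1 h)
      · obtain ⟨t, ht⟩ := h
        refine Or.inr ⟨t, fun hpt => hv (hpt.trans (List.IsPrefix.isInfix ?_)), ht⟩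
        refine List.prefix_of_prefix_length_le (ht ▸ List.prefix_append t p)
          (List.prefix_append v [x]) ?_
        have := congrArg List.length ht
        have := List.length_pos_iff.2 hne
        simp only [List.length_append, List.length_singleton] at *
        omega
      · exact absurd h hv

theorem avoidingBallots_union_eq {p : Word} (hdz : DepthZero p) (hbf : BifixFree p) (hne : p ≠ [])
    {n m : ℤ} (hn : 1 ≤ n) (hm : n ≤ m) :
    avoidingBallots p n m ∪ (· ++ p) '' avoidingBallots p (n - countR p) (m - countU p) =
      (· ++ [Step.r]) '' avoidingBallots p (n - 1) m ∪
        (· ++ [Step.u]) '' avoidingBallots p n (m - 1) := by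
  have key : ∀ w, w ∈ avoidingBallots p n m ∪
      (· ++ p) '' avoidingBallots p (n - countR p) (m - countU p) ↔
      IsBallot w n m ∧ (Avoids p w ∨ ∃ t, Avoids p t ∧ t ++ p = w) := by
    intro w
    simp only [avoidingBallots, Set.mem_union, Set.mem_image, Set.mem_ofPred_eq,
      ← hdz.isBallot_append_iff hm]
    constructor
    · rintro (⟨h, h'⟩ | ⟨t, ⟨h, h'⟩, rfl⟩)
      exacts [⟨h, Or.inl h'⟩, ⟨h, Or.inr ⟨t, h', rfl⟩⟩]
    · rintro ⟨h, h' | ⟨t, h', rfl⟩⟩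
      exacts [Or.inl ⟨h, h'⟩, Or.inr ⟨t, ⟨h, h'⟩, rfl⟩]
  ext w
  rw [key]
  obtain rfl | ⟨v, x, rfl⟩ := List.eq_nil_or_concat w
  · simp [IsBallot, countR]
    omega
  · rw [List.concat_eq_append, hbf.avoids_concat_or_iff hne]
    cases x
    · simp [avoidingBallots, isBallot_concat_u]
    · simp [avoidingBallots, isBallot_concat_r hm]

/-- Recurrence for ballot paths avoiding a depth-zero, bifix-free pattern `p` of
dimensions `a × c`: for `n ≥ 1` and `m ≥ n`,
`s p n m + s p (n-a) (m-c) = s p (n-1) m + s p n (m-1)`. -/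
theorem recurrence_bifix_free (p : Word) (a c : ℕ)
    (hdz : DepthZero p) (hbf : BifixFree p)
    (hdimR : countR p = a) (hdimU : countU p = c)
    (n m : ℤ) (hn : 1 ≤ n) (hm : n ≤ m) :
    s p n m + s p (n - a) (m - c) = s p (n - 1) m + s p n (m - 1) := by
  subst hdimR hdimU
  by_cases hne : p = []
  · have h0 : ∀ k l : ℤ, s p k l = 0 := fun k l => by simp [s, Avoids, hne]
    simp [h0]
  have h := congrArg Set.ncard (avoidingBallots_union_eq hdz hbf hne hn hm)
  have hinj : ∀ q : Word, Function.Injective (· ++ q) := fun q => List.append_left_injective q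
  rwa [Set.ncard_union_eq _ (finite_avoidingBallots _ _ _) ((finite_avoidingBallots _ _ _).image _),
    Set.ncard_union_eq _ ((finite_avoidingBallots _ _ _).image _)
      ((finite_avoidingBallots _ _ _).image _),
    Set.ncard_image_of_injective _ (hinj _), Set.ncard_image_of_injective _ (hinj _),
    Set.ncard_image_of_injective _ (hinj _)] at h
  · rw [Set.disjoint_left]
    rintro _ ⟨v, -, rfl⟩ ⟨v', -, h'⟩
    simp at h'
  · rw [Set.disjoint_right]
    rintro _ ⟨t, -, rfl⟩ h'
    exact h'.2 (List.suffix_append t p).isInfix
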